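/- Let J be a nonempty finite index set, let u_j ≥ 0 for j ∈ J, let ξ_j be {0,1}-valued random variables with P(ξ_j = 1) = p_j ∈ [0,1] (no independence required), and let τ > 0. Then E[max(0, max_{j∈J} u_j ξ_j)] ≤ τ log(Σ_{j∈J} ((e^{u_j/τ} − 1) p_j + 1)). -/

import Mathlib

open MeasureTheory ProbabilityTheory Real

/-- For `{0,1}`-valued random variables `ξ j` with `P(ξ j = 1) = p j`
(no independence required), nonnegative utilities `u j`, and `τ > 0`,
`E[max(0, max_j u j * ξ j)] ≤ τ log (∑_j ((e^{u j / τ} − 1) p j + 1))`. -/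
theorem expected_max_le_logSumExp
    {J Ω : Type*} [Fintype J] [Nonempty J] [MeasurableSpace Ω]
    (μ : Measure Ω) [IsProbabilityMeasure μ]
    (u : J → ℝ) (hu : ∀ j, 0 ≤ u j)
    (p : J → ℝ) (hp0 : ∀ j, 0 ≤ p j) (hp1 : ∀ j, p j ≤ 1)
    (ξ : J → Ω → ℝ)
    (hmeas : ∀ j, Measurable (ξ j))
    (h01 : ∀ j ω, ξ j ω = 0 ∨ ξ j ω = 1)
    (hber : ∀ j, μ {ω | ξ j ω = 1} = ENNReal.ofReal (p j))
    (τ : ℝ) (hτ : 0 < τ) :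
    ∫ ω, max 0 (⨆ j, u j * ξ j ω) ∂μ
      ≤ τ * Real.log (∑ j : J, ((Real.exp (u j / τ) - 1) * p j + 1)) := by
  have hξ : ∀ j, ξ j = Set.indicator {ω | ξ j ω = 1} (fun _ => (1 : ℝ)) := by
    intro j
    funext ω
    rcases h01 j ω with h | h <;> simp [Set.indicator, h]
  have hms : ∀ j, MeasurableSet {ω | ξ j ω = 1} := fun j =>
    hmeas j (measurableSet_singleton (1 : ℝ))
  have hint : ∀ j, Integrable (ξ j) μ := by
    intro j
    rw [hξ j]
    exact (integrable_const (1 : ℝ)).indicator (hms j)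
  have hE : ∀ j, ∫ ω, ξ j ω ∂μ = p j := by
    intro j
    have h1 : ∫ ω, ξ j ω ∂μ
        = ∫ ω, Set.indicator {ω | ξ j ω = 1} (fun _ => (1 : ℝ)) ω ∂μ := by
      rw [← hξ j]
    rw [h1, integral_indicator_const _ (hms j)]
    simp [Measure.real, hber j, hp0 j]
  have hc : ∀ j, 0 ≤ Real.exp (u j / τ) - 1 := by
    intro j
    have := Real.one_le_exp (div_nonneg (hu j) hτ.le)
    linarith
  have hint1 : ∀ j, Integrable (fun ω => (Real.exp (u j / τ) - 1) * ξ j ω + 1) μ := fun j =>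
    ((hint j).const_mul _).add (integrable_const _)
  have hξ0 : ∀ j ω, 0 ≤ ξ j ω := by
    intro j ω
    rcases h01 j ω with h | h <;> simp [h]
  set A := ∑ j : J, ((Real.exp (u j / τ) - 1) * p j + 1) with hA
  have hSint : Integrable (fun ω => ∑ j : J, ((Real.exp (u j / τ) - 1) * ξ j ω + 1)) μ :=
    integrable_finsetSum _ (fun j _ => hint1 j)
  have hSE : ∫ ω, ∑ j : J, ((Real.exp (u j / τ) - 1) * ξ j ω + 1) ∂μ = A := by
    rw [integral_finsetSum _ (fun j _ => hint1 j), hA]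
    refine Finset.sum_congr rfl fun j _ => ?_
    rw [integral_add ((hint j).const_mul _) (integrable_const _), integral_const_mul, hE]
    simp
  have hApos : 0 < A := by
    refine Finset.sum_pos (fun j _ => ?_) Finset.univ_nonempty
    have := mul_nonneg (hc j) (hp0 j)
    linarith
  have key : ∀ ω, max 0 (⨆ j, u j * ξ j ω) ≤
      τ * (Real.log A - 1 + (∑ j : J, ((Real.exp (u j / τ) - 1) * ξ j ω + 1)) / A) := by
    intro ω
    set S := ∑ j : J, ((Real.exp (u j / τ) - 1) * ξ j ω + 1) with hS
    have hnn : ∀ j, 0 ≤ (Real.exp (u j / τ) - 1) * ξ j ω := fun j =>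
      mul_nonneg (hc j) (hξ0 j ω)
    have hle : ∀ j, (Real.exp (u j / τ) - 1) * ξ j ω + 1 ≤ S := fun j =>
      Finset.single_le_sum (f := fun j => (Real.exp (u j / τ) - 1) * ξ j ω + 1)
        (fun i _ => by have := hnn i; linarith) (Finset.mem_univ j)
    have hS1 : 1 ≤ S := by
      obtain ⟨j⟩ := ‹Nonempty J›
      have := hle j
      have := hnn j
      linarith
    have hSpos : 0 < S := by linarith
    have hlog : Real.log S ≤ Real.log A - 1 + S / A := by
      have := Real.log_le_sub_one_of_pos (div_pos hSpos hApos)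
      rw [Real.log_div hSpos.ne' hApos.ne'] at this
      linarith
    refine le_trans ?_ (mul_le_mul_of_nonneg_left hlog hτ.le)
    have hl0 : 0 ≤ τ * Real.log S := mul_nonneg hτ.le (Real.log_nonneg hS1)
    refine max_le hl0 (ciSup_le fun j => ?_)
    rcases h01 j ω with h | h
    · simpa [h] using hl0
    · have h2 := hle j
      rw [h] at h2
      have h3 : u j / τ ≤ Real.log S := by
        rw [Real.le_log_iff_exp_le hSpos]
        linarith
      rw [div_le_iff₀ hτ] at h3
      rw [h]
      linarith
  have hgint : Integrable (fun ω => Real.log A - 1 +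
      (∑ j : J, ((Real.exp (u j / τ) - 1) * ξ j ω + 1)) / A) μ :=
    (integrable_const _).add (hSint.div_const A)
  refine (integral_mono_of_nonneg (Filter.Eventually.of_forall fun ω => le_max_left _ _)
    (hgint.const_mul τ) (Filter.Eventually.of_forall key)).trans (le_of_eq ?_)
  rw [integral_const_mul, integral_add (integrable_const _) (hSint.div_const A),
    integral_div, hSE, div_self hApos.ne']
  simp
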